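/- Let ι and κ be nonempty finite index sets, let M : ι × κ → ℝ have all entries positive, and let α : ι → ℝ and β : κ → ℝ be positive with Σᵢ αᵢ = Σⱼ βⱼ. Consider the transportation polytope P of matrices Z : ι × κ → ℝ with Z_{ij} ≥ 0, Σⱼ Z_{ij} = αᵢ for every i, and Σᵢ Z_{ij} = βⱼ for every j, and the function g(Z) = Σ_{i,j} (Z_{ij}·ln M_{ij} − Z_{ij}·ln Z_{ij}) (with the convention 0·ln 0 = 0). If Z* ∈ P satisfies g(Z*) ≥ g(Z) for all Z ∈ P, then there exist positive reals (Rᵢ)_{i∈ι} and (Cⱼ)_{j∈κ} such that Z*_{ij} = M_{ij}·Rᵢ·Cⱼ for all i, j, and moreover Rᵢ·Σⱼ M_{ij}·Cⱼ = αᵢ for all i and Cⱼ·Σᵢ M_{ij}·Rᵢ = βⱼ for all j. -/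

import Mathlib

lemma aux_concave (m z y t : ℝ) (hz : 0 ≤ z) (hy : 0 ≤ y) (ht0 : 0 ≤ t) (ht1 : t ≤ 1) :
    (1 - t) * (z * m - z * Real.log z) + t * (y * m - y * Real.log y) ≤
      ((1 - t) * z + t * y) * m
        - ((1 - t) * z + t * y) * Real.log ((1 - t) * z + t * y) := by
  have h := Real.concaveOn_negMulLog.2 (Set.mem_Ici.2 hz) (Set.mem_Ici.2 hy)
    (show 0 ≤ 1 - t by linarith) ht0 (by ring)
  simp only [smul_eq_mul, Real.negMulLog] at h
  linarith

lemma aux_pos {ι κ : Type*} [Fintype ι] [Fintype κ]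
    (m Z Y : ι → κ → ℝ) (hZ : ∀ i j, 0 ≤ Z i j) (hY : ∀ i j, 0 < Y i j)
    (hmax : ∀ t : ℝ, 0 < t → t < 1 →
      ∑ i, ∑ j, (((1 - t) * Z i j + t * Y i j) * m i j
        - ((1 - t) * Z i j + t * Y i j) * Real.log ((1 - t) * Z i j + t * Y i j)) ≤
      ∑ i, ∑ j, (Z i j * m i j - Z i j * Real.log (Z i j))) :
    ∀ a b, 0 < Z a b := by
  classical
  intro a b
  by_contra hneg
  have hab : Z a b = 0 := le_antisymm (not_lt.mp hneg) (hZ a b)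
  set gZ := ∑ i, ∑ j, (Z i j * m i j - Z i j * Real.log (Z i j)) with hgZ
  set gY := ∑ i, ∑ j, (Y i j * m i j - Y i j * Real.log (Y i j)) with hgY
  set K : ℝ := (|gZ - gY| + 1) / Y a b with hK
  have hKpos : 0 < K := div_pos (by positivity) (hY a b)
  set t := Real.exp (-K) with ht
  have ht0 : 0 < t := Real.exp_pos _
  have ht1 : t < 1 := by rw [ht, Real.exp_lt_one_iff]; linarith
  have h1 := hmax t ht0 ht1
  have key : (1 - t) * gZ + t * gY + t * Y a b * K ≤
      ∑ i, ∑ j, (((1 - t) * Z i j + t * Y i j) * m i j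
        - ((1 - t) * Z i j + t * Y i j) * Real.log ((1 - t) * Z i j + t * Y i j)) := by
    have e : (1 - t) * gZ + t * gY + t * Y a b * K = ∑ i, ∑ j,
        ((1 - t) * (Z i j * m i j - Z i j * Real.log (Z i j))
          + t * (Y i j * m i j - Y i j * Real.log (Y i j))
          + if i = a then (if j = b then t * Y a b * K else 0) else 0) := by
      simp only [Finset.sum_add_distrib, ← Finset.mul_sum]
      rw [← hgZ, ← hgY]
      congr 1
      rw [Finset.sum_eq_single a]
      · simp
      · intro i _ hi; simp [hi]
      · simp
    rw [e]
    refine Finset.sum_le_sum fun i _ => Finset.sum_le_sum fun j _ => ?_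
    by_cases hi : i = a
    · by_cases hj : j = b
      · subst hi; subst hj
        have hlog : Real.log (t * Y i j) = -K + Real.log (Y i j) := by
          rw [Real.log_mul ht0.ne' (hY i j).ne', ht, Real.log_exp]
        simp only [hab, if_true, mul_zero, zero_add, zero_mul, sub_zero, hlog]
        apply le_of_eq; ring
      · simp only [hi, hj, if_false, if_true, add_zero]
        exact aux_concave _ _ _ _ (hZ _ _) (hY _ _).le ht0.le ht1.le
    · simp only [hi, if_false, add_zero]
      exact aux_concave _ _ _ _ (hZ _ _) (hY _ _).le ht0.le ht1.le
  have hYK : Y a b * K = |gZ - gY| + 1 := by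
    rw [hK]; field_simp [(hY a b).ne']
  have h2 : t * (gY - gZ + (|gZ - gY| + 1)) ≤ 0 := by
    rw [← hYK]; linarith
  have h3 : 0 < gY - gZ + (|gZ - gY| + 1) := by linarith [le_abs_self (gZ - gY)]
  exact absurd h2 (not_le.mpr (mul_pos ht0 h3))

lemma aux_stationary {ι κ : Type*} [Fintype ι] [Fintype κ]
    (m Z D : ι → κ → ℝ) (hZ : ∀ i j, 0 < Z i j)
    (hmax : ∀ t : ℝ, (∀ i j, 0 ≤ Z i j + t * D i j) →
      ∑ i, ∑ j, ((Z i j + t * D i j) * m i j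
        - (Z i j + t * D i j) * Real.log (Z i j + t * D i j)) ≤
      ∑ i, ∑ j, (Z i j * m i j - Z i j * Real.log (Z i j))) :
    ∑ i, ∑ j, D i j * (m i j - Real.log (Z i j) - 1) = 0 := by
  set φ : ℝ → ℝ := fun t => ∑ i, ∑ j, ((Z i j + t * D i j) * m i j
        - (Z i j + t * D i j) * Real.log (Z i j + t * D i j)) with hφ
  have hd : HasDerivAt φ (∑ i, ∑ j, D i j * (m i j - Real.log (Z i j) - 1)) 0 := by
    refine HasDerivAt.fun_sum fun i _ => HasDerivAt.fun_sum fun j _ => ?_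
    have hl : HasDerivAt (fun t : ℝ => Z i j + t * D i j) (D i j) 0 := by
      simpa using ((hasDerivAt_id (0 : ℝ)).mul_const (D i j)).const_add (Z i j)
    have hne : Z i j + 0 * D i j ≠ 0 := by simpa using (hZ i j).ne'
    have h := (hl.mul_const (m i j)).sub (hl.mul (hl.log hne))
    refine h.congr_deriv ?_
    have := (hZ i j).ne'
    simp only [zero_mul, add_zero]
    field_simp
    ring
  have hev : ∀ᶠ t in nhds (0 : ℝ), ∀ i j, 0 ≤ Z i j + t * D i j := by
    refine Filter.eventually_all.2 fun i => Filter.eventually_all.2 fun j => ?_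
    have hc : ContinuousAt (fun t : ℝ => Z i j + t * D i j) 0 := by fun_prop
    have : ∀ᶠ t in nhds (0 : ℝ), 0 < Z i j + t * D i j :=
      hc.eventually (lt_mem_nhds (by simpa using hZ i j))
    exact this.mono fun _ h => h.le
  have hm : IsLocalMax φ 0 := by
    filter_upwards [hev] with t ht
    simpa [hφ] using hmax t ht
  exact hm.hasDerivAt_eq_zero hd


/-- Lemma 5.4 of the paper: maximum-entropy matrices with prescribed marginals
over a positive weight matrix `M` have a product form `Z*_{ij} = M_{ij} Rᵢ Cⱼ`,
with `Rᵢ, Cⱼ > 0` satisfying the marginal equations.  (Here `Real.log 0 = 0`,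
giving the convention `0·ln 0 = 0`.) -/
theorem max_entropy_product_form {ι κ : Type*} [Fintype ι] [Fintype κ]
    [Nonempty ι] [Nonempty κ]
    (M : ι → κ → ℝ) (hM : ∀ i j, 0 < M i j)
    (α : ι → ℝ) (β : κ → ℝ) (hα : ∀ i, 0 < α i) (hβ : ∀ j, 0 < β j)
    (hsum : ∑ i, α i = ∑ j, β j)
    (Z : ι → κ → ℝ)
    (hZnonneg : ∀ i j, 0 ≤ Z i j)
    (hZrow : ∀ i, ∑ j, Z i j = α i)
    (hZcol : ∀ j, ∑ i, Z i j = β j)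
    (hmax : ∀ W : ι → κ → ℝ, (∀ i j, 0 ≤ W i j) → (∀ i, ∑ j, W i j = α i) →
      (∀ j, ∑ i, W i j = β j) →
      ∑ i, ∑ j, (W i j * Real.log (M i j) - W i j * Real.log (W i j)) ≤
        ∑ i, ∑ j, (Z i j * Real.log (M i j) - Z i j * Real.log (Z i j))) :
    ∃ R : ι → ℝ, ∃ C : κ → ℝ, (∀ i, 0 < R i) ∧ (∀ j, 0 < C j) ∧
      (∀ i j, Z i j = M i j * R i * C j) ∧
      (∀ i, R i * ∑ j, M i j * C j = α i) ∧
      (∀ j, C j * ∑ i, M i j * R i = β j) := by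
  classical
  have hS : 0 < ∑ i, α i := Finset.sum_pos (fun i _ => hα i) Finset.univ_nonempty
  have hpos : ∀ i j, 0 < Z i j := by
    refine aux_pos (fun i j => Real.log (M i j)) Z (fun i j => α i * β j / ∑ i, α i) hZnonneg
      (fun i j => div_pos (mul_pos (hα i) (hβ j)) hS) ?_
    intro t ht0 ht1
    refine hmax (fun i j => (1 - t) * Z i j + t * (α i * β j / ∑ i, α i)) ?_ ?_ ?_
    · intro i j
      have h1 := div_pos (mul_pos (hα i) (hβ j)) hS
      have h2 : 0 ≤ 1 - t := by linarith
      have := mul_nonneg h2 (hZnonneg i j)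
      have := mul_pos ht0 h1
      linarith
    · intro i
      rw [Finset.sum_add_distrib, ← Finset.mul_sum, ← Finset.mul_sum, hZrow,
        ← Finset.sum_div, ← Finset.mul_sum, ← hsum, mul_div_assoc, div_self hS.ne']
      ring
    · intro j
      rw [Finset.sum_add_distrib, ← Finset.mul_sum, ← Finset.mul_sum, hZcol,
        ← Finset.sum_div, ← Finset.sum_mul, mul_div_right_comm, div_self hS.ne']
      ring
  have hst : ∀ a a' b b', (Real.log (M a b) - Real.log (Z a b))
      + (Real.log (M a' b') - Real.log (Z a' b'))
      = (Real.log (M a b') - Real.log (Z a b'))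
      + (Real.log (M a' b) - Real.log (Z a' b)) := by
    intro a a' b b'
    have h := aux_stationary (fun i j => Real.log (M i j)) Z
      (fun i j => ((if i = a then (1 : ℝ) else 0) - (if i = a' then 1 else 0))
        * ((if j = b then (1 : ℝ) else 0) - (if j = b' then 1 else 0))) hpos ?_
    · simp only [mul_assoc, ← Finset.mul_sum] at h
      simp only [sub_mul, Finset.sum_sub_distrib, ite_mul, one_mul, zero_mul,
        Finset.sum_ite_eq', Finset.mem_univ, if_true] at h
      linarith
    · intro t ht
      refine hmax (fun i j => Z i j + t * (((if i = a then (1 : ℝ) else 0)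
        - (if i = a' then 1 else 0))
        * ((if j = b then (1 : ℝ) else 0) - (if j = b' then 1 else 0)))) ht ?_ ?_
      · intro i
        rw [Finset.sum_add_distrib, ← Finset.mul_sum, ← Finset.mul_sum, hZrow]
        simp
      · intro j
        rw [Finset.sum_add_distrib, ← Finset.mul_sum, ← Finset.sum_mul, hZcol]
        simp
  obtain ⟨a⟩ := ‹Nonempty ι›
  obtain ⟨b⟩ := ‹Nonempty κ›
  have hprod : ∀ i j, Z i j = M i j * (Z i b / M i b)
      * (Z a j * M a b / (M a j * Z a b)) := by
    intro i j
    have h := hst i a j b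
    have := hM i j
    have := hM i b
    have := hM a j
    have := hM a b
    have := hpos i j
    have := hpos i b
    have := hpos a j
    have := hpos a b
    apply Real.log_injOn_pos (Set.mem_Ioi.2 (hpos i j)) (Set.mem_Ioi.2 (by positivity))
    rw [Real.log_mul (by positivity) (by positivity), Real.log_mul (by positivity) (by positivity),
      Real.log_div (by positivity) (by positivity), Real.log_div (by positivity) (by positivity),
      Real.log_mul (by positivity) (by positivity), Real.log_mul (by positivity) (by positivity)]
    linarith
  refine ⟨fun i => Z i b / M i b, fun j => Z a j * M a b / (M a j * Z a b),
    fun i => div_pos (hpos _ _) (hM _ _),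
    fun j => div_pos (mul_pos (hpos _ _) (hM _ _)) (mul_pos (hM _ _) (hpos _ _)), hprod, ?_, ?_⟩
  · intro i
    rw [← hZrow i, Finset.mul_sum]
    refine Finset.sum_congr rfl fun j _ => ?_
    refine Eq.trans ?_ (hprod i j).symm
    ring
  · intro j
    rw [← hZcol j, Finset.mul_sum]
    refine Finset.sum_congr rfl fun i _ => ?_
    refine Eq.trans ?_ (hprod i j).symm
    ring
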